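/- In the Berwald frame setting, if S I = 0 and H I = 0 (the Berwald condition) and H K = 0, then S K = 0 on N. -/

import Mathlib

/-- Derivative `X f` of a function `f` along a vector field `X`:
`(X f)(p) = df_p(X(p))`. -/
noncomputable def dAlong {E : Type*} [NormedAddCommGroup E] [NormedSpace ℝ E]
    (X : E → E) (f : E → ℝ) : E → ℝ :=
  fun p => fderiv ℝ f p (X p)

/-- Lie bracket `[X,Y]` of two vector fields. -/
noncomputable def lieB {E : Type*} [NormedAddCommGroup E] [NormedSpace ℝ E]
    (X Y : E → E) : E → E :=
  fun p => fderiv ℝ Y p (X p) - fderiv ℝ X p (Y p)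

/-- The commutator formula `[X,Y] f = X (Y f) - Y (X f)`. -/
theorem dAlong_lieB {E : Type*} [NormedAddCommGroup E] [NormedSpace ℝ E]
    {X Y : E → E} {f : E → ℝ} {p : E} (hX : DifferentiableAt ℝ X p)
    (hY : DifferentiableAt ℝ Y p) (hf : ContDiffAt ℝ 2 f p) :
    dAlong (lieB X Y) f p = dAlong X (dAlong Y f) p - dAlong Y (dAlong X f) p := by
  have hdf : DifferentiableAt ℝ (fderiv ℝ f) p :=
    (hf.fderiv_right (m := 1) (by norm_num)).differentiableAt (by norm_num)
  have hsymm : IsSymmSndFDerivAt ℝ f p := hf.isSymmSndFDerivAt (by simp)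
  have hXf : fderiv ℝ (dAlong X f) p = _ := fderiv_clm_apply hdf hX
  have hYf : fderiv ℝ (dAlong Y f) p = _ := fderiv_clm_apply hdf hY
  change fderiv ℝ f p (lieB X Y p) =
    fderiv ℝ (dAlong Y f) p (X p) - fderiv ℝ (dAlong X f) p (Y p)
  rw [hXf, hYf]
  simp [lieB, hsymm.eq (X p) (Y p)]

/-- The derivative of a function at a point depends only on its values near that point. -/
theorem dAlong_congr {E : Type*} [NormedAddCommGroup E] [NormedSpace ℝ E]
    {X : E → E} {f g : E → ℝ} {N : Set E} (hN : IsOpen N) (hfg : ∀ q ∈ N, f q = g q)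
    {p : E} (hp : p ∈ N) : dAlong X f p = dAlong X g p := by
  have h : f =ᶠ[nhds p] g := Filter.eventually_of_mem (hN.mem_nhds hp) hfg
  simp only [dAlong, h.fderiv_eq]

/-- A function vanishing on an open set has vanishing derivatives there. -/
theorem dAlong_eq_zero {E : Type*} [NormedAddCommGroup E] [NormedSpace ℝ E]
    {X : E → E} {f : E → ℝ} {N : Set E} (hN : IsOpen N) (hf : ∀ q ∈ N, f q = 0)
    {p : E} (hp : p ∈ N) : dAlong X f p = 0 := by
  rw [dAlong_congr (g := fun _ => 0) hN hf hp]
  simp [dAlong]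

/-- In the Berwald frame setting, if `S I = 0` and
`H I = 0` (the Berwald condition) and `H K = 0`, then `S K = 0` on `N`. -/
theorem statement14
    {E : Type*} [NormedAddCommGroup E] [NormedSpace ℝ E]
    (N : Set E) (hNopen : IsOpen N)
    (S H V C : E → E) (K I : E → ℝ)
    (hS : ContDiffOn ℝ (⊤ : ℕ∞) S N) (hH : ContDiffOn ℝ (⊤ : ℕ∞) H N)
    (hV : ContDiffOn ℝ (⊤ : ℕ∞) V N) (hC : ContDiffOn ℝ (⊤ : ℕ∞) C N)
    (hK : ContDiffOn ℝ (⊤ : ℕ∞) K N) (hI : ContDiffOn ℝ (⊤ : ℕ∞) I N)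
    (hSH : ∀ p ∈ N, lieB S H p = K p • V p)
    (hSV : ∀ p ∈ N, lieB S V p = -(H p))
    (hHV : ∀ p ∈ N, lieB H V p = S p + I p • H p + dAlong S I p • V p)
    (hBianchi : ∀ p ∈ N, dAlong S (dAlong S I) p + dAlong V K p + I p * K p = 0)
    (hSI : ∀ p ∈ N, dAlong S I p = 0)
    (hHI : ∀ p ∈ N, dAlong H I p = 0)
    (hHK : ∀ p ∈ N, dAlong H K p = 0) :
    ∀ p ∈ N, dAlong S K p = 0 := by
  intro p hp
  have hNp := hNopen.mem_nhds hp
  have hKp := hK.contDiffAt hNp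
  have hIp := hI.contDiffAt hNp
  have hdK : DifferentiableAt ℝ K p := hKp.differentiableAt (by simp)
  have hdI : DifferentiableAt ℝ I p := hIp.differentiableAt (by simp)
  have hVK : ∀ q ∈ N, dAlong V K q = -(I q * K q) := fun q hq => by
    have hSSI : dAlong S (dAlong S I) q = 0 := dAlong_eq_zero hNopen hSI hq
    linarith [hBianchi q hq]
  have hHVK : dAlong H (dAlong V K) p = 0 := by
    rw [dAlong_congr hNopen hVK hp]
    have hHIp : fderiv ℝ I p (H p) = 0 := hHI p hp
    have hHKp : fderiv ℝ K p (H p) = 0 := hHK p hp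
    simp [dAlong, fderiv_fun_neg, fderiv_fun_mul hdI hdK, hHIp, hHKp]
  have hVHK : dAlong V (dAlong H K) p = 0 := dAlong_eq_zero hNopen hHK hp
  have hcomm := dAlong_lieB ((hH.contDiffAt hNp).differentiableAt (by simp))
    ((hV.contDiffAt hNp).differentiableAt (by simp))
    (hKp.of_le (WithTop.coe_le_coe.2 le_top))
  have hHKp : fderiv ℝ K p (H p) = 0 := hHK p hp
  rw [hHVK, hVHK, sub_zero, dAlong, hHV p hp, hSI p hp] at hcomm
  simpa [hHKp, dAlong] using hcomm
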